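/- Assume there is ε ∈ (0,1) with ‖K* − K̄‖_F ≤ (ε/2)·√(λ_min(Γ)) / (√(λ_min(Γ))·‖S B_a‖_F + ‖S B_u‖_F), let L > 0 be a Lipschitz constant of ∇J̃ on S₀, and assume 0 < ω < (2/L)·λ_min(Γ⁻¹)/λ_max(Γ⁻¹)². Then the iteration produces a monotonically nonincreasing cost: J̃(Λ^{i+1}) ≤ J̃(Λ^i) for all i ∈ ℕ. -/

import Mathlib

open Matrix Filter Topology

noncomputable section

/-- A real square matrix is Hurwitz if every complex eigenvalue has strictly
negative real part. -/
def IsHurwitz {N : ℕ} (M : Matrix (Fin N) (Fin N) ℝ) : Prop :=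
  ∀ μ : ℂ, μ ∈ spectrum ℂ (M.map (algebraMap ℝ ℂ)) → μ.re < 0

/-- Frobenius norm of a real matrix. -/
def frobNorm {p q : ℕ} (M : Matrix (Fin p) (Fin q) ℝ) : ℝ :=
  Real.sqrt (Matrix.trace (Mᵀ * M))

/-- Minimal eigenvalue of a (Hermitian) real matrix. -/
def eigMin {m : ℕ} (M : Matrix (Fin m) (Fin m) ℝ) : ℝ :=
  if hM : M.IsHermitian then ⨅ i, hM.eigenvalues i else 0

/-- Maximal eigenvalue of a (Hermitian) real matrix. -/
def eigMax {m : ℕ} (M : Matrix (Fin m) (Fin m) ℝ) : ℝ :=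
  if hM : M.IsHermitian then ⨆ i, hM.eigenvalues i else 0

variable {n m_u m_a : ℕ}

/-- `P` is the stabilizing solution of the spoofed ARE for the gain `Λ`. -/
def IsStabSol (A : Matrix (Fin n) (Fin n) ℝ) (Bu : Matrix (Fin n) (Fin m_u) ℝ)
    (Ba : Matrix (Fin n) (Fin m_a) ℝ) (Q : Matrix (Fin n) (Fin n) ℝ)
    (R : Matrix (Fin m_a) (Fin m_a) ℝ)
    (Λ : Matrix (Fin m_u) (Fin n) ℝ) (P : Matrix (Fin n) (Fin n) ℝ) : Prop :=
  P.PosDef ∧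
  (A + Bu * Λ)ᵀ * P + P * (A + Bu * Λ) + Q + P * Ba * R⁻¹ * Baᵀ * P = 0 ∧
  IsHurwitz (A + Bu * Λ + Ba * R⁻¹ * Baᵀ * P)

/-- `Pim` is a symmetric solution of the Lyapunov equation defining `Π(Λ)`,
given the stabilizing ARE solution `P = P_u(Λ)`. -/
def IsLyapSol (A : Matrix (Fin n) (Fin n) ℝ) (Bu : Matrix (Fin n) (Fin m_u) ℝ)
    (Ba : Matrix (Fin n) (Fin m_a) ℝ) (R : Matrix (Fin m_a) (Fin m_a) ℝ)
    (Kbar : Matrix (Fin m_a) (Fin n) ℝ)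
    (Λ : Matrix (Fin m_u) (Fin n) ℝ) (P Pim : Matrix (Fin n) (Fin n) ℝ) : Prop :=
  Pim.IsHermitian ∧
  (A + Bu * Λ + Ba * R⁻¹ * Baᵀ * P) * Pim + Pim * (A + Bu * Λ + Ba * R⁻¹ * Baᵀ * P)ᵀ
    - Kbarᵀ * R⁻¹ * Baᵀ - Ba * R⁻¹ * Kbar
    + P * Ba * (R⁻¹ * R⁻¹) * Baᵀ + Ba * (R⁻¹ * R⁻¹) * Baᵀ * P = 0

/-- The deception cost `J̃(Λ)`, expressed through a choice function `Pu` for the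
stabilizing solution of the spoofed ARE. -/
def Jcost (Ba : Matrix (Fin n) (Fin m_a) ℝ) (R : Matrix (Fin m_a) (Fin m_a) ℝ)
    (Γ : Matrix (Fin m_u) (Fin m_u) ℝ) (Kbar : Matrix (Fin m_a) (Fin n) ℝ)
    (Pu : Matrix (Fin m_u) (Fin n) ℝ → Matrix (Fin n) (Fin n) ℝ)
    (Λ : Matrix (Fin m_u) (Fin n) ℝ) : ℝ :=
  frobNorm (R⁻¹ * Baᵀ * Pu Λ - Kbar) ^ 2 + Matrix.trace (Λᵀ * Γ * Λ)

/-- The sublevel set `S₀`. -/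
def S0 (A : Matrix (Fin n) (Fin n) ℝ) (Bu : Matrix (Fin n) (Fin m_u) ℝ)
    (Ba : Matrix (Fin n) (Fin m_a) ℝ) (Q : Matrix (Fin n) (Fin n) ℝ)
    (R : Matrix (Fin m_a) (Fin m_a) ℝ) (Γ : Matrix (Fin m_u) (Fin m_u) ℝ)
    (Kbar : Matrix (Fin m_a) (Fin n) ℝ)
    (Pu : Matrix (Fin m_u) (Fin n) ℝ → Matrix (Fin n) (Fin n) ℝ) :
    Set (Matrix (Fin m_u) (Fin n) ℝ) :=
  {Λ | (∃ P, IsStabSol A Bu Ba Q R Λ P) ∧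
    Jcost Ba R Γ Kbar Pu Λ ≤ Jcost Ba R Γ Kbar Pu 0}

section Auxiliary

/-- Local solvability of a perturbed Riccati equation in a finite-dimensional algebra, whenever the
linearized (Sylvester) operator at the base solution is injective. -/
theorem exists_hasDerivAt_riccati {𝔸 : Type*} [NormedRing 𝔸] [NormedAlgebra ℝ 𝔸]
    [FiniteDimensional ℝ 𝔸] (a' a b' b q g x₀ : 𝔸)
    (hx₀ : a' * x₀ + x₀ * a + q + x₀ * g * x₀ = 0)
    (hinj : ∀ y, (a' + x₀ * g) * y + y * (a + g * x₀) = 0 → y = 0) :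
    ∃ (x : ℝ → 𝔸) (x' : 𝔸), x 0 = x₀ ∧ HasDerivAt x x' 0 ∧
      (a' + x₀ * g) * x' + x' * (a + g * x₀) + b' * x₀ + x₀ * b = 0 ∧
      ∀ᶠ t in 𝓝 (0 : ℝ),
        (a' + t • b') * x t + x t * (a + t • b) + q + x t * g * x t = 0 := by
  have : CompleteSpace 𝔸 := FiniteDimensional.complete ℝ 𝔸
  let f : ℝ × 𝔸 → 𝔸 := fun v =>
    (a' + v.1 • b') * v.2 + v.2 * (a + v.1 • b) + q + v.2 * g * v.2
  have hf : ContDiff ℝ 1 f := by fun_prop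
  have hs : HasStrictFDerivAt f (fderiv ℝ f (0, x₀)) (0, x₀) :=
    hf.contDiffAt.hasStrictFDerivAt one_ne_zero
  have hcurve : ∀ (u : ℝ → ℝ) (x : ℝ → 𝔸) (u' : ℝ) (x' : 𝔸), u 0 = 0 → x 0 = x₀ →
      HasDerivAt u u' 0 → HasDerivAt x x' 0 →
      HasDerivAt (fun t => f (u t, x t))
        ((a' + x₀ * g) * x' + x' * (a + g * x₀) + u' • (b' * x₀ + x₀ * b)) 0 := by
    intro u x u' x' hu0 hx0 hu hx
    have h := (((((hu.smul_const b').const_add a').mul hx).add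
      (hx.mul ((hu.smul_const b).const_add a))).add_const q).add ((hx.mul_const g).mul hx)
    refine h.congr_deriv ?_
    simp only [hu0, hx0, zero_smul, add_zero, smul_add]
    simp only [add_mul, mul_add, smul_mul_assoc, mul_smul_comm, mul_assoc]
    abel
  have hpartial : ∀ y, (fderiv ℝ f (0, x₀) ∘L .inr ℝ ℝ 𝔸) y
      = (a' + x₀ * g) * y + y * (a + g * x₀) := by
    intro y
    have hx : HasDerivAt (fun t : ℝ => x₀ + t • y) y 0 := by
      simpa using ((hasDerivAt_id (0 : ℝ)).smul_const y).const_add x₀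
    have h1 := hcurve (fun _ => 0) _ 0 y rfl (by simp) (hasDerivAt_const _ _) hx
    have h2 : HasDerivAt (fun t : ℝ => f (0, x₀ + t • y)) (fderiv ℝ f (0, x₀) (0, y)) 0 := by
      have hs' : HasFDerivAt f (fderiv ℝ f (0, x₀)) ((fun t : ℝ => ((0 : ℝ), x₀ + t • y)) 0) := by
        simpa using hs.hasFDerivAt
      have hc : HasDerivAt (fun t : ℝ => ((0 : ℝ), x₀ + t • y)) ((0 : ℝ), y) 0 :=
        (hasDerivAt_const _ _).prodMk hx
      exact hs'.comp_hasDerivAt (0 : ℝ) hc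
    simpa using h2.unique h1
  have hinv : (fderiv ℝ f (0, x₀) ∘L .inr ℝ ℝ 𝔸).IsInvertible := by
    have hker : ((fderiv ℝ f (0, x₀) ∘L .inr ℝ ℝ 𝔸 : 𝔸 →L[ℝ] 𝔸) : 𝔸 →ₗ[ℝ] 𝔸).ker = ⊥ := by
      rw [LinearMap.ker_eq_bot']
      intro y hy
      exact hinj y (by rw [← hpartial y]; exact hy)
    have hinj' := LinearMap.ker_eq_bot.mp hker
    refine ⟨(LinearEquiv.ofInjectiveEndo _ hinj').toContinuousLinearEquiv, ?_⟩
    ext y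
    simp
  have hψ := hs.hasStrictFDerivAt_implicitFunctionOfProdDomain hinv
  have hev := hs.eventually_apply_implicitFunctionOfProdDomain hinv
  have h0 := (hs.eventually_apply_eq_iff_implicitFunctionOfProdDomain hinv).self_of_nhds.mp rfl
  set ψ := hs.implicitFunctionOfProdDomain hinv
  have hf0 : f (0, x₀) = 0 := by simpa [f] using hx₀
  simp only [hf0] at hev h0
  have hd := hψ.hasFDerivAt.hasDerivAt
  refine ⟨ψ, _, h0, hd, ?_, hev⟩
  have h1 := hcurve (fun t => t) ψ 1 _ rfl h0 (hasDerivAt_id (0 : ℝ)) hd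
  have h2 : HasDerivAt (fun t => f (t, ψ t)) 0 0 :=
    (hasDerivAt_const (0 : ℝ) (0 : 𝔸)).congr_of_eventuallyEq hev
  have h3 := h1.unique h2
  rwa [one_smul, ← add_assoc] at h3

theorem isHurwitz_transpose {N : ℕ} {M : Matrix (Fin N) (Fin N) ℝ} (hM : IsHurwitz M) :
    IsHurwitz Mᵀ := by
  intro μ hμ
  refine hM μ ?_
  rw [Matrix.mem_spectrum_iff_isRoot_charpoly] at hμ ⊢
  rwa [Matrix.transpose_map, Matrix.charpoly_transpose] at hμ

/-- The Sylvester equation `M X + X N = 0` with Hurwitz coefficients has only the zero solution. -/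
theorem eq_zero_of_sylvester {N : ℕ} {M M' X : Matrix (Fin N) (Fin N) ℝ}
    (hM : IsHurwitz M) (hM' : IsHurwitz M') (h : M * X + X * M' = 0) : X = 0 := by
  set c : Matrix (Fin N) (Fin N) ℝ → Matrix (Fin N) (Fin N) ℂ := fun Y => Y.map (algebraMap ℝ ℂ)
  have hc : c M * c X = c X * -c M' := by
    have : c (M * X + X * M') = 0 := by rw [h]; ext; simp [c]
    have h2 : c (M * X + X * M') = c M * c X + c X * c M' := by
      simp only [c]
      rw [Matrix.map_add _ (map_add _), Matrix.map_mul, Matrix.map_mul]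
    rw [mul_neg, ← add_eq_zero_iff_eq_neg, ← h2, this]
  set p := (-c M').charpoly
  have hp : Polynomial.aeval (c M) p * c X = 0 := by
    have : ∀ q : Polynomial ℂ,
        Polynomial.aeval (c M) q * c X = c X * Polynomial.aeval (-c M') q := by
      intro q
      induction q using Polynomial.induction_on' with
      | add p q hp hq => simp only [map_add, add_mul, mul_add, hp, hq]
      | monomial k a =>
        have hk : c M ^ k * c X = c X * (-c M') ^ k :=
          (show SemiconjBy (c X) (-c M') (c M) from hc.symm).pow_right k |>.symm
        simp only [Polynomial.aeval_monomial, mul_assoc, hk]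
        rw [← mul_assoc, Algebra.commutes, mul_assoc]
    rw [this, Matrix.aeval_self_charpoly, mul_zero]
  have hu : IsUnit (Polynomial.aeval (c M) p) := by
    cases N with
    | zero => exact isUnit_of_subsingleton _
    | succ N =>
    rw [← spectrum.zero_notMem_iff ℂ]
    intro h0
    rw [spectrum.map_polynomial_aeval_of_nonempty (c M) p
      (spectrum.nonempty_of_isAlgClosed_of_finiteDimensional ℂ (c M))] at h0
    obtain ⟨k, hk, hk0⟩ := h0
    have h1 := hM k hk
    have h2 : k ∈ spectrum ℂ (-c M') := Matrix.mem_spectrum_iff_isRoot_charpoly.mpr hk0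
    have h3 : -k ∈ spectrum ℂ (c M') := by
      rw [← spectrum.neg_eq] at h2
      simpa using h2
    have := hM' _ h3
    simp at this
    linarith
  have hX : c X = 0 := by
    have := congrArg (fun Y => Ring.inverse (Polynomial.aeval (c M) p) * Y) hp
    simpa [← mul_assoc, Ring.inverse_mul_cancel _ hu] using this
  ext i j
  have := congrFun (congrFun hX i) j
  simpa [c] using this

/-- Lyapunov's criterion. -/
theorem isHurwitz_of_lyapunov {N : ℕ} {M S : Matrix (Fin N) (Fin N) ℝ} (hS : S.PosDef)
    (h : ∀ x : Fin N → ℝ, x ≠ 0 → x ⬝ᵥ ((Mᵀ * S + S * M) *ᵥ x) < 0) : IsHurwitz M := by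
  intro μ hμ
  rw [← Matrix.spectrum_toLin', ← Module.End.hasEigenvalue_iff_mem_spectrum] at hμ
  obtain ⟨v, hv⟩ := hμ.exists_hasEigenvector
  have hv0 := hv.2
  have hve : (M.map (algebraMap ℝ ℂ)) *ᵥ v = μ • v := by simpa using hv.apply_eq_smul
  set x : Fin N → ℝ := fun i => (v i).re
  set y : Fin N → ℝ := fun i => (v i).im
  have hx : M *ᵥ x = μ.re • x - μ.im • y := by
    ext i
    have := congrArg Complex.re (congrFun hve i)
    simpa [Matrix.mulVec, dotProduct, x, y] using this
  have hy : M *ᵥ y = μ.im • x + μ.re • y := by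
    ext i
    have := congrArg Complex.im (congrFun hve i)
    simp [Matrix.mulVec, dotProduct, x, y] at this ⊢
    linarith
  have hSt : Sᵀ = S := by simpa using hS.1.eq
  have hq : ∀ z : Fin N → ℝ, z ⬝ᵥ ((Mᵀ * S + S * M) *ᵥ z) = 2 * (z ⬝ᵥ (S *ᵥ (M *ᵥ z))) := by
    intro z
    have : z ⬝ᵥ (Mᵀ *ᵥ (S *ᵥ z)) = z ⬝ᵥ (S *ᵥ (M *ᵥ z)) := by
      rw [Matrix.dotProduct_mulVec, Matrix.vecMul_transpose, Matrix.dotProduct_mulVec z,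
        ← Matrix.mulVec_transpose, hSt, dotProduct_comm]
    rw [Matrix.add_mulVec, dotProduct_add, ← Matrix.mulVec_mulVec, ← Matrix.mulVec_mulVec, this]
    ring
  have hsymm : y ⬝ᵥ (S *ᵥ x) = x ⬝ᵥ (S *ᵥ y) := by
    rw [Matrix.dotProduct_mulVec, ← Matrix.mulVec_transpose, hSt, dotProduct_comm]
  have hsum : x ⬝ᵥ ((Mᵀ * S + S * M) *ᵥ x) + y ⬝ᵥ ((Mᵀ * S + S * M) *ᵥ y)
      = 2 * μ.re * (x ⬝ᵥ (S *ᵥ x) + y ⬝ᵥ (S *ᵥ y)) := by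
    rw [hq, hq, hx, hy]
    simp only [Matrix.mulVec_sub, Matrix.mulVec_add, Matrix.mulVec_smul, dotProduct_sub,
      dotProduct_add, dotProduct_smul, smul_eq_mul, hsymm]
    ring
  have hnn : ∀ z : Fin N → ℝ, 0 ≤ z ⬝ᵥ (S *ᵥ z) := fun z => by
    simpa using hS.posSemidef.dotProduct_mulVec_nonneg z
  have hnp : ∀ z : Fin N → ℝ, z ⬝ᵥ ((Mᵀ * S + S * M) *ᵥ z) ≤ 0 := fun z => by
    by_cases hz : z = 0
    · simp [hz]
    · exact (h z hz).le
  have hlt : x ⬝ᵥ ((Mᵀ * S + S * M) *ᵥ x) + y ⬝ᵥ ((Mᵀ * S + S * M) *ᵥ y) < 0 := by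
    by_cases hx0 : x = 0
    · have hy0 : y ≠ 0 := fun hy0 => hv0 <| by
        ext i
        exact Complex.ext (congrFun hx0 i) (congrFun hy0 i)
      linarith [hnp x, h y hy0]
    · linarith [hnp y, h x hx0]
  by_contra! hre
  have := mul_nonneg (mul_nonneg zero_le_two hre) (add_nonneg (hnn x) (hnn y))
  linarith

section Eigen

variable {m : ℕ} {M : Matrix (Fin m) (Fin m) ℝ}

theorem eigMin_mul_le (hM : M.IsHermitian) (x : Fin m → ℝ) :
    eigMin M * (x ⬝ᵥ x) ≤ x ⬝ᵥ (M *ᵥ x) := by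
  have hH : (M - algebraMap ℝ _ (eigMin M)).IsHermitian :=
    hM.sub (by simp [Matrix.IsHermitian, Matrix.algebraMap_eq_diagonal])
  have hps : (M - algebraMap ℝ _ (eigMin M)).PosSemidef := by
    rw [hH.posSemidef_iff_eigenvalues_nonneg]
    intro i
    have h := hH.eigenvalues_mem_spectrum_real i
    rw [← spectrum.sub_singleton_eq] at h
    obtain ⟨a, ha, b, hb, hab⟩ := Set.mem_sub.mp h
    rw [hM.spectrum_real_eq_range_eigenvalues] at ha
    obtain ⟨j, rfl⟩ := ha
    rw [Set.mem_singleton_iff] at hb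
    have : eigMin M ≤ hM.eigenvalues j := by
      rw [eigMin, dif_pos hM]
      exact ciInf_le (Set.finite_range _).bddBelow j
    simp only [Pi.zero_apply]
    linarith
  have := hps.dotProduct_mulVec_nonneg x
  simp only [star_trivial, Matrix.sub_mulVec, dotProduct_sub, Algebra.algebraMap_eq_smul_one] at this
  simp only [Matrix.smul_mulVec, Matrix.one_mulVec, dotProduct_smul, smul_eq_mul] at this
  linarith

theorem exists_eigenvalues_eq_eigMin [Nonempty (Fin m)] (hM : M.IsHermitian) :
    ∃ i, hM.eigenvalues i = eigMin M := by
  rw [eigMin, dif_pos hM]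
  exact exists_eq_ciInf_of_finite

theorem eigMin_pos [Nonempty (Fin m)] (hM : M.PosDef) : 0 < eigMin M := by
  obtain ⟨i, hi⟩ := exists_eigenvalues_eq_eigMin hM.1
  exact hi ▸ hM.eigenvalues_pos i

theorem exists_mul_le_of_posDef (hM : M.PosDef) :
    ∃ c > 0, ∀ x : Fin m → ℝ, c * (x ⬝ᵥ x) ≤ x ⬝ᵥ (M *ᵥ x) := by
  rcases isEmpty_or_nonempty (Fin m) with hm | hm
  · exact ⟨1, one_pos, fun x => by simp [dotProduct]⟩
  · exact ⟨eigMin M, eigMin_pos hM, eigMin_mul_le hM.1⟩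

theorem eigenvalues_le_eigMax (hM : M.IsHermitian) (i : Fin m) : hM.eigenvalues i ≤ eigMax M := by
  rw [eigMax, dif_pos hM]
  exact le_ciSup (Set.finite_range _).bddAbove i

theorem eigMin_le_eigMax [Nonempty (Fin m)] (hM : M.IsHermitian) : eigMin M ≤ eigMax M := by
  obtain ⟨i, hi⟩ := exists_eigenvalues_eq_eigMin hM
  exact hi ▸ eigenvalues_le_eigMax hM i

theorem inv_eigMin_le_eigMax_inv [Nonempty (Fin m)] (hM : M.PosDef) :
    (eigMin M)⁻¹ ≤ eigMax M⁻¹ := by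
  obtain ⟨i, hi⟩ := exists_eigenvalues_eq_eigMin hM.1
  have h1 : (eigMin M)⁻¹ ∈ spectrum ℝ M⁻¹ := by
    have h := hM.1.eigenvalues_mem_spectrum_real i
    rw [hi] at h
    have hu : ((hM.isUnit.unit⁻¹ : (Matrix (Fin m) (Fin m) ℝ)ˣ) : Matrix (Fin m) (Fin m) ℝ)
        = M⁻¹ := by simp [Matrix.coe_units_inv]
    have := (spectrum.inv_mem_iff (r := Units.mk0 _ (eigMin_pos hM).ne')
      (a := hM.isUnit.unit)).mp (by simpa using h)
    rw [hu] at this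
    simpa using this
  rw [hM.inv.1.spectrum_real_eq_range_eigenvalues] at h1
  obtain ⟨j, hj⟩ := h1
  exact hj ▸ eigenvalues_le_eigMax hM.inv.1 j

open scoped MatrixOrder in
theorem exists_transpose_mul_self_of_posSemidef (hM : M.PosSemidef) :
    ∃ Y : Matrix (Fin m) (Fin m) ℝ, M = Yᵀ * Y := by
  obtain ⟨Y, hY⟩ := CStarAlgebra.nonneg_iff_eq_star_mul_self.mp hM.nonneg
  exact ⟨Y, by simpa [Matrix.star_eq_conjTranspose] using hY⟩

end Eigen

attribute [local instance] Matrix.frobeniusNormedAddCommGroup Matrix.frobeniusNormedSpace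
  Matrix.frobeniusNormedRing Matrix.frobeniusNormedAlgebra

section Frobenius

variable {p q r : ℕ}

theorem trace_transpose_mul_eq_sum (X Y : Matrix (Fin p) (Fin q) ℝ) :
    trace (Xᵀ * Y) = ∑ i, ∑ j, X i j * Y i j := by
  simp only [trace, Matrix.diag_apply, Matrix.mul_apply, Matrix.transpose_apply]
  exact Finset.sum_comm

theorem frobenius_norm_sq (M : Matrix (Fin p) (Fin q) ℝ) : ‖M‖ ^ 2 = trace (Mᵀ * M) := by
  have h : 0 ≤ ∑ i, ∑ j, ‖M i j‖ ^ (2 : ℝ) := by positivity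
  rw [Matrix.frobenius_norm_def, ← Real.sqrt_eq_rpow, Real.sq_sqrt h, trace_transpose_mul_eq_sum]
  simp [← sq]

theorem frobNorm_eq_norm (M : Matrix (Fin p) (Fin q) ℝ) : frobNorm M = ‖M‖ := by
  rw [frobNorm, ← frobenius_norm_sq, Real.sqrt_sq (norm_nonneg _)]

theorem trace_transpose_mul_le (X Y : Matrix (Fin p) (Fin q) ℝ) :
    trace (Xᵀ * Y) ≤ ‖X‖ * ‖Y‖ := by
  refine abs_le_of_sq_le_sq' ?_ (by positivity) |>.2
  rw [mul_pow, frobenius_norm_sq, frobenius_norm_sq]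
  simp only [trace_transpose_mul_eq_sum, ← Fintype.sum_prod_type', ← sq]
  exact Finset.sum_mul_sq_le_sq_mul_sq _ _ _

theorem dotProduct_mulVec_le (X : Matrix (Fin p) (Fin p) ℝ) (x : Fin p → ℝ) :
    x ⬝ᵥ (X *ᵥ x) ≤ ‖X‖ * (x ⬝ᵥ x) := by
  have h0 : 0 ≤ x ⬝ᵥ x := dotProduct_self_star_nonneg x
  have h1 : ‖vecMulVec x x‖ = x ⬝ᵥ x := by
    rw [← Real.sqrt_sq (norm_nonneg _), frobenius_norm_sq, Matrix.transpose_vecMulVec,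
      Matrix.vecMulVec_mul_vecMulVec, Matrix.trace_vecMulVec, dotProduct_smul, smul_eq_mul,
      Real.sqrt_mul_self h0]
  have h2 : x ⬝ᵥ (X *ᵥ x) = trace (Xᵀ * vecMulVec x x) := by
    rw [trace_transpose_mul_eq_sum]
    simp only [dotProduct, mulVec, vecMulVec_apply, Finset.mul_sum]
    exact Finset.sum_congr rfl fun i _ => Finset.sum_congr rfl fun j _ => by ring
  rw [h2, ← h1]
  exact trace_transpose_mul_le _ _

theorem mul_norm_sq_le_trace {c : ℝ} {N : Matrix (Fin q) (Fin q) ℝ}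
    (h : ∀ x, c * (x ⬝ᵥ x) ≤ x ⬝ᵥ (N *ᵥ x)) (Z : Matrix (Fin p) (Fin q) ℝ) :
    c * ‖Z‖ ^ 2 ≤ trace (Z * N * Zᵀ) := by
  rw [frobenius_norm_sq, Matrix.trace_mul_comm, Matrix.mul_assoc]
  simp only [trace, Matrix.diag_apply, Finset.mul_sum]
  refine Finset.sum_le_sum fun i _ => (h (Z i)).trans_eq ?_
  simp [dotProduct, Matrix.mul_apply, mulVec]

theorem norm_transpose_mul_self_le (Y : Matrix (Fin p) (Fin q) ℝ) : ‖Yᵀ * Y‖ ≤ ‖Y‖ ^ 2 := by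
  rw [sq]
  simpa [Matrix.frobenius_norm_transpose] using Matrix.frobenius_norm_mul Yᵀ Y

theorem posDef_of_norm_sub_lt {c : ℝ} {P P' : Matrix (Fin p) (Fin p) ℝ} (hP' : P'.IsHermitian)
    (h : ∀ x, c * (x ⬝ᵥ x) ≤ x ⬝ᵥ (P *ᵥ x)) (hlt : ‖P - P'‖ < c) : P'.PosDef := by
  refine .of_dotProduct_mulVec_pos hP' fun x hx => ?_
  have hx0 : 0 < x ⬝ᵥ x := by
    simpa using dotProduct_star_self_pos_iff.mpr hx
  have h1 := dotProduct_mulVec_le (P - P') x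
  rw [Matrix.sub_mulVec, dotProduct_sub] at h1
  simp only [star_trivial]
  nlinarith [h x]

end Frobenius

section Riccati

variable {A : Matrix (Fin n) (Fin n) ℝ} {Bu : Matrix (Fin n) (Fin m_u) ℝ}
  {Ba : Matrix (Fin n) (Fin m_a) ℝ} {Q : Matrix (Fin n) (Fin n) ℝ}
  {R : Matrix (Fin m_a) (Fin m_a) ℝ} {Λ : Matrix (Fin m_u) (Fin n) ℝ}

theorem transpose_feedback (hR : R.PosDef) : (Ba * R⁻¹ * Baᵀ)ᵀ = Ba * R⁻¹ * Baᵀ := by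
  have : (R⁻¹)ᵀ = R⁻¹ := by simpa using hR.inv.1.eq
  simp [Matrix.transpose_mul, this, Matrix.mul_assoc]

theorem sylvester_of_riccati {F P₁ P₂ G : Matrix (Fin n) (Fin n) ℝ}
    (h₁ : Fᵀ * P₁ + P₁ * F + Q + P₁ * G * P₁ = 0) (h₂ : Fᵀ * P₂ + P₂ * F + Q + P₂ * G * P₂ = 0) :
    (Fᵀ + P₁ * G) * (P₁ - P₂) + (P₁ - P₂) * (F + G * P₂) = 0 := by
  have : (Fᵀ + P₁ * G) * (P₁ - P₂) + (P₁ - P₂) * (F + G * P₂)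
      = (Fᵀ * P₁ + P₁ * F + Q + P₁ * G * P₁) - (Fᵀ * P₂ + P₂ * F + Q + P₂ * G * P₂) := by
    noncomm_ring
  rw [this, h₁, h₂, sub_zero]

theorem isHermitian_of_riccati {F P G : Matrix (Fin n) (Fin n) ℝ} (hQ : Q.IsHermitian)
    (hG : Gᵀ = G) (h : Fᵀ * P + P * F + Q + P * G * P = 0) (hF : IsHurwitz (F + G * P)) :
    P.IsHermitian := by
  have hQ' : Qᵀ = Q := by simpa using hQ.eq
  have h' : Fᵀ * Pᵀ + Pᵀ * F + Q + Pᵀ * G * Pᵀ = 0 := by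
    have := congrArg Matrix.transpose h
    simp only [Matrix.transpose_add, Matrix.transpose_mul, Matrix.transpose_transpose, hQ', hG,
      Matrix.transpose_zero] at this
    rw [← this, Matrix.mul_assoc]
    abel
  have h2 := sylvester_of_riccati h' h
  rw [show Fᵀ + Pᵀ * G = (F + G * P)ᵀ by simp [hG]] at h2
  have := eq_zero_of_sylvester (isHurwitz_transpose hF) hF h2
  simpa [Matrix.IsHermitian] using sub_eq_zero.mp this

theorem IsStabSol.riccati {P : Matrix (Fin n) (Fin n) ℝ} (h : IsStabSol A Bu Ba Q R Λ P) :
    (A + Bu * Λ)ᵀ * P + P * (A + Bu * Λ) + Q + P * (Ba * R⁻¹ * Baᵀ) * P = 0 := by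
  simpa only [Matrix.mul_assoc] using h.2.1

theorem IsStabSol.unique (hR : R.PosDef) {P₁ P₂ : Matrix (Fin n) (Fin n) ℝ}
    (h₁ : IsStabSol A Bu Ba Q R Λ P₁) (h₂ : IsStabSol A Bu Ba Q R Λ P₂) : P₁ = P₂ := by
  have h := sylvester_of_riccati h₁.riccati h₂.riccati
  have hP : P₁ᵀ = P₁ := by simpa using h₁.1.1.eq
  rw [show (A + Bu * Λ)ᵀ + P₁ * (Ba * R⁻¹ * Baᵀ) = (A + Bu * Λ + Ba * R⁻¹ * Baᵀ * P₁)ᵀ by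
    rw [Matrix.transpose_add _ (_ * P₁), Matrix.transpose_mul _ P₁, transpose_feedback hR, hP]] at h
  exact sub_eq_zero.mp (eq_zero_of_sylvester (isHurwitz_transpose h₁.2.2) h₂.2.2 h)

theorem posDef_of_posSemidef_of_riccati {F P G : Matrix (Fin n) (Fin n) ℝ} (hQ : Q.PosDef)
    (hP : P.PosSemidef) (h : Fᵀ * P + P * F + Q + P * G * P = 0) : P.PosDef := by
  refine .of_dotProduct_mulVec_pos hP.1 fun x hx => ?_
  refine lt_of_le_of_ne (hP.dotProduct_mulVec_nonneg x) fun h0 => ?_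
  have hPx : P *ᵥ x = 0 := (hP.dotProduct_mulVec_zero_iff x).mp h0.symm
  have hP' : Pᵀ = P := by simpa using hP.1.eq
  have hxP : x ᵥ* P = 0 := by rw [← Matrix.mulVec_transpose, hP', hPx]
  have h1 := congrArg (fun Y => x ⬝ᵥ (Y *ᵥ x)) h
  simp only [Matrix.add_mulVec, dotProduct_add, ← Matrix.mulVec_mulVec, hPx, Matrix.mulVec_zero,
    dotProduct_zero, Matrix.zero_mulVec] at h1
  rw [Matrix.dotProduct_mulVec x P, hxP, zero_dotProduct] at h1
  have := hQ.dotProduct_mulVec_pos hx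
  simp only [star_trivial] at this
  linarith

/-- An a priori bound for solutions of the Riccati equation whose closed loop has `S` as a strict
Lyapunov function. -/
theorem norm_le_of_riccati {F P : Matrix (Fin n) (Fin n) ℝ} (hR : R.PosDef)
    {S : Matrix (Fin n) (Fin n) ℝ} (hS : S.PosDef) (hP : P.PosSemidef)
    (h : Fᵀ * P + P * F + Q + P * (Ba * R⁻¹ * Baᵀ) * P = 0) {c : ℝ} (hc : 0 < c)
    (hlyap : ∀ x, c * (x ⬝ᵥ x) ≤ x ⬝ᵥ ((-((F + Ba * R⁻¹ * Baᵀ * P)ᵀ * S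
      + S * (F + Ba * R⁻¹ * Baᵀ * P))) *ᵥ x)) :
    ‖P‖ ≤ trace (S⁻¹ * Q) / c * ‖S‖ ^ 2 := by
  obtain ⟨Y, hY⟩ := exists_transpose_mul_self_of_posSemidef hP
  obtain ⟨V, hV⟩ := exists_transpose_mul_self_of_posSemidef hS.inv.posSemidef
  have hG := transpose_feedback (Ba := Ba) hR
  have hPt : Pᵀ = P := by simpa using hP.1.eq
  have hSt : (S⁻¹)ᵀ = S⁻¹ := by simpa using hS.inv.1.eq
  have hSS : S * S⁻¹ = 1 := Matrix.mul_nonsing_inv _ ((Matrix.isUnit_iff_isUnit_det _).mp hS.isUnit)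
  have hSS' : S⁻¹ * S = 1 := Matrix.nonsing_inv_mul _ ((Matrix.isUnit_iff_isUnit_det _).mp hS.isUnit)
  set G := Ba * R⁻¹ * Baᵀ with hGdef
  set M := F + G * P with hM
  have hMP : Mᵀ * P + P * M = P * G * P - Q := by
    have : Mᵀ = Fᵀ + P * G := by rw [hM, Matrix.transpose_add, Matrix.transpose_mul, hPt, hG]
    rw [this, hM, ← sub_eq_zero, ← h]
    noncomm_ring
  have h1 := mul_norm_sq_le_trace hlyap (Y * S⁻¹)
  have h2 : trace (Y * S⁻¹ * (-(Mᵀ * S + S * M)) * (Y * S⁻¹)ᵀ)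
      = trace (S⁻¹ * Q) - trace (S⁻¹ * (P * G * P)) := by
    have e1 : Y * S⁻¹ * (-(Mᵀ * S + S * M)) * (Y * S⁻¹)ᵀ
        = -(Y * (S⁻¹ * Mᵀ + M * S⁻¹) * Yᵀ) := by
      rw [Matrix.transpose_mul, hSt]
      calc _ = -(Y * (S⁻¹ * Mᵀ * (S * S⁻¹) + (S⁻¹ * S) * M * S⁻¹) * Yᵀ) := by noncomm_ring
        _ = _ := by rw [hSS, hSS', Matrix.mul_one, Matrix.one_mul]
    rw [e1, Matrix.trace_neg, Matrix.trace_mul_comm, ← Matrix.mul_assoc, ← hY, Matrix.mul_add,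
      Matrix.trace_add, Matrix.trace_mul_comm P (S⁻¹ * Mᵀ), ← Matrix.mul_assoc P M,
      Matrix.trace_mul_comm (P * M), Matrix.mul_assoc, ← Matrix.trace_add, ← Matrix.mul_add, hMP,
      Matrix.mul_sub, Matrix.trace_sub, neg_sub]
  have h3 : 0 ≤ trace (S⁻¹ * (P * G * P)) := by
    have hps : (P * G * P).PosSemidef := by
      have := hR.inv.posSemidef.mul_mul_conjTranspose_same (P * Ba)
      simpa [hGdef, Matrix.transpose_mul, hPt, Matrix.mul_assoc] using this
    rw [hV, Matrix.mul_assoc, Matrix.trace_mul_comm]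
    simpa using (hps.mul_mul_conjTranspose_same V).trace_nonneg
  have h4 : ‖Y * S⁻¹‖ ^ 2 ≤ trace (S⁻¹ * Q) / c := by
    rw [le_div_iff₀ hc]
    linarith
  have h5 : ‖Y‖ ≤ ‖Y * S⁻¹‖ * ‖S‖ := by
    calc ‖Y‖ = ‖Y * S⁻¹ * S‖ := by rw [Matrix.mul_assoc, hSS', Matrix.mul_one]
      _ ≤ _ := norm_mul_le _ _
  calc ‖P‖ ≤ ‖Y‖ ^ 2 := hY ▸ norm_transpose_mul_self_le Y
    _ ≤ (‖Y * S⁻¹‖ * ‖S‖) ^ 2 := by gcongr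
    _ = ‖Y * S⁻¹‖ ^ 2 * ‖S‖ ^ 2 := mul_pow _ _ _
    _ ≤ _ := by gcongr

/-- Along a line through a point where the stabilizing solution exists, there is a differentiable
curve of stabilizing solutions. -/
theorem IsStabSol.exists_hasDerivAt (hQ : Q.PosDef) (hR : R.PosDef)
    {P S : Matrix (Fin n) (Fin n) ℝ} (h : IsStabSol A Bu Ba Q R Λ P) (hS : S.PosDef)
    {c : ℝ} (hc : 0 < c)
    (hlyap : ∀ x, c * (x ⬝ᵥ x) ≤ x ⬝ᵥ ((-((A + Bu * Λ + Ba * R⁻¹ * Baᵀ * P)ᵀ * S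
      + S * (A + Bu * Λ + Ba * R⁻¹ * Baᵀ * P))) *ᵥ x))
    (D : Matrix (Fin m_u) (Fin n) ℝ) :
    ∃ (X : ℝ → Matrix (Fin n) (Fin n) ℝ) (X' : Matrix (Fin n) (Fin n) ℝ),
      X 0 = P ∧ HasDerivAt X X' 0 ∧ X'ᵀ = X' ∧
      (A + Bu * Λ + Ba * R⁻¹ * Baᵀ * P)ᵀ * X' + X' * (A + Bu * Λ + Ba * R⁻¹ * Baᵀ * P)
        + (Bu * D)ᵀ * P + P * (Bu * D) = 0 ∧
      ∀ᶠ t in 𝓝 (0 : ℝ), IsStabSol A Bu Ba Q R (Λ + t • D) (X t) := by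
  have hP : Pᵀ = P := by simpa using h.1.1.eq
  have hG := transpose_feedback (Ba := Ba) hR
  have hM := h.2.2
  have hMt : (A + Bu * Λ)ᵀ + P * (Ba * R⁻¹ * Baᵀ) = (A + Bu * Λ + Ba * R⁻¹ * Baᵀ * P)ᵀ := by
    rw [Matrix.transpose_add _ (_ * P), Matrix.transpose_mul _ P, hG, hP]
  obtain ⟨X, X', h0, hX, hX', hev⟩ := exists_hasDerivAt_riccati (A + Bu * Λ)ᵀ (A + Bu * Λ)
    (Bu * D)ᵀ (Bu * D) Q (Ba * R⁻¹ * Baᵀ) P h.riccati (by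
      rw [hMt]
      exact fun y hy => eq_zero_of_sylvester (isHurwitz_transpose h.2.2) h.2.2 hy)
  rw [hMt] at hX'
  have hXt : X'ᵀ = X' := by
    generalize A + Bu * Λ + Ba * R⁻¹ * Baᵀ * P = M at hX' hM
    have ht := congrArg Matrix.transpose hX'
    simp only [Matrix.transpose_add, Matrix.transpose_mul, Matrix.transpose_transpose, hP,
      Matrix.transpose_zero] at ht hX'
    refine sub_eq_zero.mp (eq_zero_of_sylvester (isHurwitz_transpose hM) hM ?_)
    rw [← sub_self (0 : Matrix (Fin n) (Fin n) ℝ)]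
    nth_rewrite 1 [← ht]
    rw [← hX']
    noncomm_ring
  refine ⟨X, X', h0, hX, hXt, hX', ?_⟩
  have hXc : ContinuousAt X 0 := hX.continuousAt
  have hcl : ContinuousAt (fun t : ℝ => -((A + Bu * (Λ + t • D) + Ba * R⁻¹ * Baᵀ * X t)ᵀ * S
      + S * (A + Bu * (Λ + t • D) + Ba * R⁻¹ * Baᵀ * X t))) 0 := by
    fun_prop
  have hnear := hcl.eventually (Metric.ball_mem_nhds _ hc)
  obtain ⟨d, hd, hdP⟩ := exists_mul_le_of_posDef h.1
  have hnearP := hXc.eventually (Metric.ball_mem_nhds _ hd)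
  filter_upwards [hev, hnear, hnearP] with t ht htM htP
  have hric : (A + Bu * (Λ + t • D))ᵀ * X t + X t * (A + Bu * (Λ + t • D)) + Q
      + X t * (Ba * R⁻¹ * Baᵀ) * X t = 0 := by
    rw [← ht]
    simp [Matrix.mul_add, add_assoc]
  have hHur : IsHurwitz (A + Bu * (Λ + t • D) + Ba * R⁻¹ * Baᵀ * X t) := by
    refine isHurwitz_of_lyapunov hS fun x hx => ?_
    rw [dist_comm, dist_eq_norm] at htM
    have hSt : Sᵀ = S := by simpa using hS.1.eq
    have := (posDef_of_norm_sub_lt (by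
      simp [Matrix.IsHermitian, Matrix.transpose_mul, hSt, add_comm])
      (by simpa [h0] using hlyap) htM).dotProduct_mulVec_pos hx
    rw [Matrix.neg_mulVec, dotProduct_neg] at this
    simpa using this
  refine ⟨posDef_of_norm_sub_lt (isHermitian_of_riccati hQ.1 hG hric hHur) hdP ?_, ?_, hHur⟩
  · rwa [dist_comm, dist_eq_norm, h0] at htP
  · simpa only [Matrix.mul_assoc] using hric

end Riccati

section Cost

variable {A : Matrix (Fin n) (Fin n) ℝ} {Bu : Matrix (Fin n) (Fin m_u) ℝ}
  {Ba : Matrix (Fin n) (Fin m_a) ℝ} {Q : Matrix (Fin n) (Fin n) ℝ}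
  {R : Matrix (Fin m_a) (Fin m_a) ℝ} {Γ : Matrix (Fin m_u) (Fin m_u) ℝ}
  {Kbar : Matrix (Fin m_a) (Fin n) ℝ} {Λ : Matrix (Fin m_u) (Fin n) ℝ}
  {Pu : Matrix (Fin m_u) (Fin n) ℝ → Matrix (Fin n) (Fin n) ℝ}

theorem eigMin_mul_norm_sq_le_trace (hΓ : Γ.IsHermitian) (Z : Matrix (Fin m_u) (Fin n) ℝ) :
    eigMin Γ * ‖Z‖ ^ 2 ≤ trace (Zᵀ * Γ * Z) := by
  simpa [Matrix.frobenius_norm_transpose] using mul_norm_sq_le_trace (eigMin_mul_le hΓ) Zᵀ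

theorem lyapunov_of_cost_le [Nonempty (Fin m_u)] (hΓ : Γ.PosDef)
    {S : Matrix (Fin n) (Fin n) ℝ} (hS : S.PosDef) {K₀ K : Matrix (Fin m_a) (Fin n) ℝ}
    (hSeq : (A + Ba * K₀)ᵀ * S + S * (A + Ba * K₀)
      + (2 : ℝ) • (1 : Matrix (Fin n) (Fin n) ℝ) = 0) {ε : ℝ} (hε : 0 < ε)
    (hdist : ‖K₀ - Kbar‖ ≤ (ε / 2) * (Real.sqrt (eigMin Γ) /
      (Real.sqrt (eigMin Γ) * ‖S * Ba‖ + ‖S * Bu‖)))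
    (hcost : ‖K - Kbar‖ ^ 2 + trace (Λᵀ * Γ * Λ) ≤ ‖K₀ - Kbar‖ ^ 2) (x : Fin n → ℝ) :
    2 * (1 - ε) * (x ⬝ᵥ x) ≤
      x ⬝ᵥ ((-((A + Bu * Λ + Ba * K)ᵀ * S + S * (A + Bu * Λ + Ba * K))) *ᵥ x) := by
  have hSt : Sᵀ = S := by simpa using hS.1.eq
  set δ := ‖K₀ - Kbar‖
  set l := Real.sqrt (eigMin Γ)
  have hl : 0 < l := Real.sqrt_pos.mpr (eigMin_pos hΓ)
  have hl2 : l ^ 2 = eigMin Γ := Real.sq_sqrt (eigMin_pos hΓ).le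
  have hδ : 0 ≤ δ := norm_nonneg _
  have htr := eigMin_mul_norm_sq_le_trace hΓ.1 Λ
  rw [← hl2, ← mul_pow] at htr
  have hK : ‖K - Kbar‖ ≤ δ := by
    refine abs_le_of_sq_le_sq' ?_ hδ |>.2
    nlinarith [sq_nonneg (l * ‖Λ‖)]
  have hΛ : l * ‖Λ‖ ≤ δ := by
    refine abs_le_of_sq_le_sq' ?_ hδ |>.2
    nlinarith [sq_nonneg ‖K - Kbar‖]
  have hKK : ‖K - K₀‖ ≤ 2 * δ := by
    have := norm_sub_le (K - Kbar) (K₀ - Kbar)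
    rw [sub_sub_sub_cancel_right] at this
    linarith
  have hsmall : ‖S * Ba‖ * ‖K - K₀‖ + ‖S * Bu‖ * ‖Λ‖ ≤ ε := by
    have h1 : δ * (l * ‖S * Ba‖ + ‖S * Bu‖) ≤ ε / 2 * l := by
      rcases (by positivity : 0 ≤ l * ‖S * Ba‖ + ‖S * Bu‖).eq_or_lt with h | h
      · rw [← h, mul_zero]; positivity
      · rwa [← mul_div_assoc, le_div_iff₀ h] at hdist
    refine le_of_mul_le_mul_left ?_ hl
    have h2 : l * ‖S * Ba‖ * ‖K - K₀‖ ≤ l * ‖S * Ba‖ * (2 * δ) := by gcongr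
    have h3 : ‖S * Bu‖ * (l * ‖Λ‖) ≤ ‖S * Bu‖ * δ := by gcongr
    have h4 : 0 ≤ ‖S * Bu‖ * δ := by positivity
    linarith
  set E := S * Bu * Λ + S * Ba * (K - K₀) with hE
  have hEn : ‖E + Eᵀ‖ ≤ 2 * ε := by
    have h1 := norm_add_le E Eᵀ
    have h2 := norm_add_le (S * Bu * Λ) (S * Ba * (K - K₀))
    have h3 := Matrix.frobenius_norm_mul (S * Bu) Λ
    have h4 := Matrix.frobenius_norm_mul (S * Ba) (K - K₀)
    rw [Matrix.frobenius_norm_transpose] at h1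
    linarith
  have hsplit : -((A + Bu * Λ + Ba * K)ᵀ * S + S * (A + Bu * Λ + Ba * K))
      = (2 : ℝ) • (1 : Matrix (Fin n) (Fin n) ℝ) - (E + Eᵀ) := by
    rw [← eq_neg_iff_add_eq_zero] at hSeq
    rw [eq_sub_iff_add_eq, ← neg_neg ((2 : ℝ) • (1 : Matrix (Fin n) (Fin n) ℝ)), ← hSeq, hE]
    simp only [Matrix.transpose_add, Matrix.transpose_mul, Matrix.transpose_sub, hSt,
      Matrix.mul_add, Matrix.add_mul, Matrix.mul_sub, Matrix.mul_assoc]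
    abel
  have hq := dotProduct_mulVec_le (E + Eᵀ) x
  have hxx : 0 ≤ x ⬝ᵥ x := dotProduct_self_star_nonneg x
  rw [hsplit, Matrix.sub_mulVec, dotProduct_sub, Matrix.smul_mulVec, Matrix.one_mulVec,
    dotProduct_smul, smul_eq_mul]
  nlinarith

theorem HasDerivAt.trace_transpose_mul {p q : ℕ} {f g : ℝ → Matrix (Fin p) (Fin q) ℝ}
    {f' g' : Matrix (Fin p) (Fin q) ℝ} {s : ℝ} (hf : HasDerivAt f f' s) (hg : HasDerivAt g g' s) :
    HasDerivAt (fun t => trace ((f t)ᵀ * g t)) (trace (f'ᵀ * g s) + trace ((f s)ᵀ * g')) s := by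
  have hentry : ∀ {h : ℝ → Matrix (Fin p) (Fin q) ℝ} {h' : Matrix (Fin p) (Fin q) ℝ} (i j),
      HasDerivAt h h' s → HasDerivAt (fun t => h t i j) (h' i j) s := fun i j hh =>
    (Matrix.entryLinearMap ℝ ℝ i j).toContinuousLinearMap.hasFDerivAt.comp_hasDerivAt s hh
  simp only [trace_transpose_mul_eq_sum, ← Finset.sum_add_distrib]
  exact HasDerivAt.fun_sum fun i _ => HasDerivAt.fun_sum fun j _ =>
    (hentry i j hf).mul (hentry i j hg)

theorem HasDerivAt.const_matrix_mul {p q r : ℕ} (C : Matrix (Fin r) (Fin p) ℝ)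
    {f : ℝ → Matrix (Fin p) (Fin q) ℝ} {f' : Matrix (Fin p) (Fin q) ℝ} {s : ℝ}
    (hf : HasDerivAt f f' s) : HasDerivAt (fun t => C * f t) (C * f') s :=
  (mulLeftLinearMap (Fin q) ℝ C).toContinuousLinearMap.hasFDerivAt.comp_hasDerivAt s hf

/-- The derivative of the cost along a line, expressed through the adjoint variable. -/
theorem hasDerivAt_cost (hR : R.PosDef) (hΓ : Γ.PosDef) {P Pim : Matrix (Fin n) (Fin n) ℝ}
    (hP : P.IsHermitian) (hPim : IsLyapSol A Bu Ba R Kbar Λ P Pim)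
    {D : Matrix (Fin m_u) (Fin n) ℝ} {X : ℝ → Matrix (Fin n) (Fin n) ℝ}
    {X' : Matrix (Fin n) (Fin n) ℝ} (h0 : X 0 = P) (hX : HasDerivAt X X' 0)
    (hXt : X'ᵀ = X')
    (hX' : (A + Bu * Λ + Ba * R⁻¹ * Baᵀ * P)ᵀ * X' + X' * (A + Bu * Λ + Ba * R⁻¹ * Baᵀ * P)
        + (Bu * D)ᵀ * P + P * (Bu * D) = 0) :
    HasDerivAt (fun t : ℝ => ‖R⁻¹ * Baᵀ * X t - Kbar‖ ^ 2
        + trace ((Λ + t • D)ᵀ * Γ * (Λ + t • D)))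
      (trace (((2 : ℝ) • (Γ * Λ + Buᵀ * P * Pim))ᵀ * D)) 0 := by
  have hPt : Pᵀ = P := by simpa using hP.eq
  have hPimt : Pimᵀ = Pim := by simpa using hPim.1.eq
  have hRt : (R⁻¹)ᵀ = R⁻¹ := by simpa using hR.inv.1.eq
  have hΓt : Γᵀ = Γ := by simpa using hΓ.1.eq
  have hK := (hX.const_matrix_mul (R⁻¹ * Baᵀ)).sub_const Kbar
  have hL : HasDerivAt (fun t : ℝ => Λ + t • D) D 0 :=
    (((hasDerivAt_id (0 : ℝ)).smul_const D).const_add Λ).congr_deriv (one_smul _ _)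
  have h := (hK.trace_transpose_mul hK).add (hL.trace_transpose_mul (hL.const_matrix_mul Γ))
  simp only [← Matrix.mul_assoc] at h
  simp only [frobenius_norm_sq]
  refine h.congr_deriv ?_
  simp only [h0, zero_smul, add_zero]
  set M := A + Bu * Λ + Ba * R⁻¹ * Baᵀ * P with hM
  set E := R⁻¹ * Baᵀ * P - Kbar with hE
  set C := Ba * R⁻¹ * E with hC
  have hlyap : M * Pim + Pim * Mᵀ + C + Cᵀ = 0 := by
    rw [← hPim.2, ← hM, hC, hE]
    simp only [Matrix.transpose_mul, Matrix.transpose_sub, Matrix.transpose_transpose, hRt, hPt,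
      Matrix.mul_sub, Matrix.mul_assoc]
    abel
  have h1 := congrArg (fun Y => trace (X' * Y)) hlyap
  have h2 := congrArg (fun Y => trace (Pim * Y)) hX'
  simp only [Matrix.mul_add, Matrix.trace_add, Matrix.mul_zero, Matrix.trace_zero] at h1 h2
  have e1 : trace (X' * (M * Pim)) = trace (Pim * (X' * M)) := by
    rw [← Matrix.mul_assoc, Matrix.trace_mul_comm]
  have e2 : trace (X' * (Pim * Mᵀ)) = trace (Pim * (Mᵀ * X')) := by
    rw [Matrix.trace_mul_comm, Matrix.mul_assoc]
  have e3 : trace (X' * Cᵀ) = trace (X' * C) := by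
    rw [← Matrix.trace_transpose, Matrix.transpose_mul, hXt, Matrix.transpose_transpose,
      Matrix.trace_mul_comm]
  have e4 : trace (Pim * ((Bu * D)ᵀ * P)) = trace (Pim * (P * (Bu * D))) := by
    rw [← Matrix.trace_transpose, Matrix.transpose_mul, Matrix.transpose_mul,
      Matrix.transpose_transpose, hPt, hPimt, Matrix.trace_mul_comm]
  have e5 : trace ((R⁻¹ * Baᵀ * X')ᵀ * E) = trace (X' * C) := by
    rw [hC]
    simp only [Matrix.transpose_mul, Matrix.transpose_transpose, hRt, hXt, Matrix.mul_assoc]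
  have e6 : trace (Eᵀ * R⁻¹ * Baᵀ * X') = trace (X' * C) := by
    rw [← e5, ← Matrix.trace_transpose]
    simp only [Matrix.transpose_mul, Matrix.transpose_transpose, Matrix.mul_assoc]
  have e7 : trace (Dᵀ * Γ * Λ) = trace (Λᵀ * Γ * D) := by
    rw [← Matrix.trace_transpose]
    simp only [Matrix.transpose_mul, Matrix.transpose_transpose, hΓt, Matrix.mul_assoc]
  have e8 : trace (((2 : ℝ) • (Γ * Λ + Buᵀ * P * Pim))ᵀ * D)
      = 2 * (trace (Λᵀ * Γ * D) + trace (Pim * (P * (Bu * D)))) := by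
    simp only [Matrix.transpose_smul, Matrix.smul_mul, Matrix.trace_smul, smul_eq_mul,
      Matrix.transpose_add, Matrix.transpose_mul, Matrix.transpose_transpose, hΓt, hPt, hPimt,
      Matrix.add_mul, Matrix.trace_add, Matrix.mul_assoc]
  rw [e5, e6, e7, e8]
  linarith

theorem isClosed_S0 (hQ : Q.PosDef) (hR : R.PosDef)
    (hPu : ∀ Λ, (∃ P, IsStabSol A Bu Ba Q R Λ P) → IsStabSol A Bu Ba Q R Λ (Pu Λ))
    {S : Matrix (Fin n) (Fin n) ℝ} (hS : S.PosDef) {c : ℝ} (hc : 0 < c)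
    (hlyap : ∀ (Λ : Matrix (Fin m_u) (Fin n) ℝ) (P : Matrix (Fin n) (Fin n) ℝ),
      ‖R⁻¹ * Baᵀ * P - Kbar‖ ^ 2 + trace (Λᵀ * Γ * Λ) ≤ Jcost Ba R Γ Kbar Pu 0 →
      ∀ x, c * (x ⬝ᵥ x) ≤ x ⬝ᵥ ((-((A + Bu * Λ + Ba * R⁻¹ * Baᵀ * P)ᵀ * S
        + S * (A + Bu * Λ + Ba * R⁻¹ * Baᵀ * P))) *ᵥ x)) :
    IsClosed (S0 A Bu Ba Q R Γ Kbar Pu) := by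
  have : SequentialSpace (Matrix (Fin m_u) (Fin n) ℝ) :=
    inferInstanceAs (SequentialSpace (Fin m_u → Fin n → ℝ))
  refine IsSeqClosed.isClosed fun Λs Λ hΛs hlim => ?_
  let V : Set (Matrix (Fin m_u) (Fin n) ℝ × Matrix (Fin n) (Fin n) ℝ) :=
    {v | (v.2ᵀ = v.2 ∧ ∀ x, 0 ≤ x ⬝ᵥ (v.2 *ᵥ x)) ∧
      (A + Bu * v.1)ᵀ * v.2 + v.2 * (A + Bu * v.1) + Q + v.2 * (Ba * R⁻¹ * Baᵀ) * v.2 = 0 ∧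
      ‖R⁻¹ * Baᵀ * v.2 - Kbar‖ ^ 2 + trace (v.1ᵀ * Γ * v.1) ≤ Jcost Ba R Γ Kbar Pu 0}
  have hnn : IsClosed {v : Matrix (Fin m_u) (Fin n) ℝ × Matrix (Fin n) (Fin n) ℝ |
      ∀ x, 0 ≤ x ⬝ᵥ (v.2 *ᵥ x)} := by
    simp only [Set.ofPred_forall]
    exact isClosed_iInter fun x => isClosed_le continuous_const
      (continuous_const.dotProduct (continuous_snd.matrix_mulVec continuous_const))
  have hcost : Continuous fun v : Matrix (Fin m_u) (Fin n) ℝ × Matrix (Fin n) (Fin n) ℝ =>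
      ‖R⁻¹ * Baᵀ * v.2 - Kbar‖ ^ 2 + trace (v.1ᵀ * Γ * v.1) := by
    simp only [frobenius_norm_sq]
    exact Continuous.add (Continuous.matrix_trace (by fun_prop))
      (Continuous.matrix_trace (by fun_prop))
  have hV : IsClosed V :=
    ((isClosed_eq (by fun_prop) (by fun_prop)).inter hnn).inter
      ((isClosed_eq (by fun_prop) (by fun_prop)).inter (isClosed_le hcost continuous_const))
  have hmem : ∀ k, (Λs k, Pu (Λs k)) ∈ V := fun k => by
    have h := hPu _ (hΛs k).1
    have hJ := (hΛs k).2
    rw [Jcost, frobNorm_eq_norm] at hJ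
    exact ⟨⟨by simpa using h.1.1.eq, fun x => by
      simpa using h.1.posSemidef.dotProduct_mulVec_nonneg x⟩, h.riccati, hJ⟩
  have hbdd : ∀ k, Pu (Λs k) ∈ Metric.closedBall 0 (trace (S⁻¹ * Q) / c * ‖S‖ ^ 2) := fun k => by
    have h := hPu _ (hΛs k).1
    rw [mem_closedBall_zero_iff]
    exact norm_le_of_riccati hR hS h.1.posSemidef h.riccati hc (hlyap _ _ (hmem k).2.2)
  have : ProperSpace (Matrix (Fin n) (Fin n) ℝ) := FiniteDimensional.proper_real _
  obtain ⟨P, -, φ, hφ, hP⟩ := (isCompact_closedBall _ _).tendsto_subseq hbdd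
  have hlimV : (Λ, P) ∈ V :=
    hV.mem_of_tendsto ((hlim.comp hφ.tendsto_atTop).prodMk_nhds hP)
      (Eventually.of_forall fun k => hmem (φ k))
  obtain ⟨⟨hPt, hPnn⟩, hric, hJ⟩ := hlimV
  have hps : P.PosSemidef :=
    .of_dotProduct_mulVec_nonneg (by simpa [Matrix.IsHermitian] using hPt) (by simpa using hPnn)
  have hstab : IsStabSol A Bu Ba Q R Λ P := by
    refine ⟨posDef_of_posSemidef_of_riccati hQ hps hric, by simpa only [Matrix.mul_assoc] using hric,
      isHurwitz_of_lyapunov hS fun x hx => ?_⟩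
    have h1 := hlyap _ _ hJ x
    have hx0 : 0 < x ⬝ᵥ x := by simpa using dotProduct_star_self_pos_iff.mpr hx
    rw [Matrix.neg_mulVec, dotProduct_neg] at h1
    nlinarith
  refine ⟨⟨P, hstab⟩, ?_⟩
  rw [Jcost, frobNorm_eq_norm, (hPu _ ⟨P, hstab⟩).unique hR hstab]
  exact hJ

end Cost
/-- A function on `[0, ω]` with negative derivative wherever it stays in a closed sublevel region
that is open to the right does not increase between the endpoints. -/
theorem le_of_sublevel_continuation {φ φ' : ℝ → ℝ} {U : Set ℝ} {ω : ℝ} (hω : 0 ≤ ω)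
    (hU : IsClosed U) (h0 : 0 ∈ U) (hnhds : ∀ s ∈ U, 0 ≤ s → s < ω → U ∈ 𝓝[>] s)
    (hd : ∀ s ∈ U, HasDerivAt φ (φ' s) s) (hneg : ∀ s ∈ U, 0 ≤ s → s ≤ ω → φ' s ≤ 0) :
    ω ∈ U ∧ φ ω ≤ φ 0 := by
  have hsub : Set.Icc 0 ω ⊆ U :=
    (hU.inter isClosed_Icc).Icc_subset_of_forall_mem_nhdsWithin h0
      fun x hx => hnhds x hx.1 hx.2.1 hx.2.2
  refine ⟨hsub ⟨hω, le_rfl⟩, ?_⟩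
  have hanti : AntitoneOn φ (Set.Icc 0 ω) := by
    refine antitoneOn_of_deriv_nonpos (convex_Icc 0 ω)
      (fun s hs => (hd s (hsub hs)).continuousAt.continuousWithinAt)
      (fun s hs => (hd s (hsub (interior_subset hs))).differentiableAt.differentiableWithinAt)
      fun s hs => ?_
    have hs' := interior_subset hs
    rw [(hd s (hsub hs')).deriv]
    exact hneg s (hsub hs') hs'.1 hs'.2
  exact hanti ⟨le_rfl, hω⟩ ⟨hω, le_rfl⟩ hω

section Descent

variable {A : Matrix (Fin n) (Fin n) ℝ} {Bu : Matrix (Fin n) (Fin m_u) ℝ}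
  {Ba : Matrix (Fin n) (Fin m_a) ℝ} {Q : Matrix (Fin n) (Fin n) ℝ}
  {R : Matrix (Fin m_a) (Fin m_a) ℝ} {Γ : Matrix (Fin m_u) (Fin m_u) ℝ}
  {Kbar : Matrix (Fin m_a) (Fin n) ℝ}
  {Pu Pim : Matrix (Fin m_u) (Fin n) ℝ → Matrix (Fin n) (Fin n) ℝ}

/-- One step of the iteration stays in the sublevel set and does not increase the cost. -/
theorem descent_step [Nonempty (Fin m_u)] (hQ : Q.PosDef) (hR : R.PosDef) (hΓ : Γ.PosDef)
    (hPu : ∀ Λ, (∃ P, IsStabSol A Bu Ba Q R Λ P) → IsStabSol A Bu Ba Q R Λ (Pu Λ))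
    (hPim : ∀ Λ, (∃ P, IsStabSol A Bu Ba Q R Λ P) →
      IsLyapSol A Bu Ba R Kbar Λ (Pu Λ) (Pim Λ))
    {S : Matrix (Fin n) (Fin n) ℝ} (hS : S.PosDef) {c : ℝ} (hc : 0 < c)
    (hlyap : ∀ (Λ : Matrix (Fin m_u) (Fin n) ℝ) (P : Matrix (Fin n) (Fin n) ℝ),
      ‖R⁻¹ * Baᵀ * P - Kbar‖ ^ 2 + trace (Λᵀ * Γ * Λ) ≤ Jcost Ba R Γ Kbar Pu 0 →
      ∀ x, c * (x ⬝ᵥ x) ≤ x ⬝ᵥ ((-((A + Bu * Λ + Ba * R⁻¹ * Baᵀ * P)ᵀ * S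
        + S * (A + Bu * Λ + Ba * R⁻¹ * Baᵀ * P))) *ᵥ x))
    {L : ℝ} (hL : 0 < L)
    (hLip : ∀ Λ₁ ∈ S0 A Bu Ba Q R Γ Kbar Pu, ∀ Λ₂ ∈ S0 A Bu Ba Q R Γ Kbar Pu,
      ‖(2 : ℝ) • (Γ * Λ₁ + Buᵀ * Pu Λ₁ * Pim Λ₁) -
          (2 : ℝ) • (Γ * Λ₂ + Buᵀ * Pu Λ₂ * Pim Λ₂)‖ ≤ L * ‖Λ₁ - Λ₂‖)
    {ω : ℝ} (hω0 : 0 < ω) (hω : L * ω < 2 * eigMin Γ)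
    {Λ D : Matrix (Fin m_u) (Fin n) ℝ} (hΛ : Λ ∈ S0 A Bu Ba Q R Γ Kbar Pu)
    (hD : Γ * Λ + Buᵀ * Pu Λ * Pim Λ = -(Γ * D)) :
    Λ + ω • D ∈ S0 A Bu Ba Q R Γ Kbar Pu ∧
      Jcost Ba R Γ Kbar Pu (Λ + ω • D) ≤ Jcost Ba R Γ Kbar Pu Λ := by
  rcases eq_or_ne D 0 with rfl | hD0
  · simpa using hΛ
  set g : Matrix (Fin m_u) (Fin n) ℝ → Matrix (Fin m_u) (Fin n) ℝ :=
    fun Y => (2 : ℝ) • (Γ * Y + Buᵀ * Pu Y * Pim Y) with hg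
  have hlocal : ∀ s : ℝ, Λ + s • D ∈ S0 A Bu Ba Q R Γ Kbar Pu →
      (∀ᶠ u in 𝓝 s, ∃ P, IsStabSol A Bu Ba Q R (Λ + u • D) P) ∧
      HasDerivAt (fun u : ℝ => Jcost Ba R Γ Kbar Pu (Λ + u • D))
        (trace ((g (Λ + s • D))ᵀ * D)) s := by
    intro s hs
    have hst := hPu _ hs.1
    have hJ := hs.2
    rw [Jcost, frobNorm_eq_norm] at hJ
    obtain ⟨X, X', hX0, hX, hXt, hX', hev⟩ :=
      hst.exists_hasDerivAt hQ hR hS hc (hlyap _ _ hJ) D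
    have hd := hasDerivAt_cost hR hΓ hst.1.1 (hPim _ hs.1) hX0 hX hXt hX'
    have hshift : Tendsto (fun u : ℝ => u - s) (𝓝 s) (𝓝 0) := by
      have : ContinuousAt (fun u : ℝ => u - s) s := by fun_prop
      simpa [ContinuousAt] using this
    have hev' := hshift.eventually hev
    have hadd : ∀ u : ℝ, Λ + s • D + (u - s) • D = Λ + u • D := fun u => by
      rw [add_assoc, ← add_smul, add_sub_cancel]
    simp only [hadd] at hev'
    refine ⟨hev'.mono fun u hu => ⟨_, hu⟩, ?_⟩
    rw [← sub_self s] at hd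
    refine (hd.comp_sub_const s s).congr_of_eventuallyEq ?_
    filter_upwards [hev'] with u hu
    rw [Jcost, frobNorm_eq_norm, (hPu _ ⟨_, hu⟩).unique hR hu, hadd]
  have hDpos : 0 < ‖D‖ := norm_pos_iff.mpr hD0
  have hneg : ∀ s : ℝ, Λ + s • D ∈ S0 A Bu Ba Q R Γ Kbar Pu → 0 ≤ s → s ≤ ω →
      trace ((g (Λ + s • D))ᵀ * D) < 0 := by
    intro s hs hs0 hsω
    have hΓt : Γᵀ = Γ := by simpa using hΓ.1.eq
    have h1 := trace_transpose_mul_le (g (Λ + s • D) - g Λ) D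
    have h2 := hLip _ hs _ hΛ
    rw [add_sub_cancel_left, norm_smul, Real.norm_of_nonneg hs0] at h2
    have h3 : trace ((g Λ)ᵀ * D) = -2 * trace (Dᵀ * Γ * D) := by
      change trace (((2 : ℝ) • (Γ * Λ + Buᵀ * Pu Λ * Pim Λ))ᵀ * D) = _
      rw [hD]
      simp [Matrix.transpose_mul, hΓt]
    have h4 := eigMin_mul_norm_sq_le_trace hΓ.1 D
    rw [Matrix.transpose_sub, Matrix.sub_mul, Matrix.trace_sub, h3] at h1
    have h5 : ‖g (Λ + s • D) - g Λ‖ * ‖D‖ ≤ L * (ω * ‖D‖) * ‖D‖ := by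
      refine mul_le_mul_of_nonneg_right (h2.trans ?_) hDpos.le
      gcongr
    nlinarith [mul_lt_mul_of_pos_right hω (sq_pos_of_pos hDpos)]
  have hline : Continuous fun s : ℝ => Λ + s • D := by fun_prop
  have key := le_of_sublevel_continuation
    (φ := fun s => Jcost Ba R Γ Kbar Pu (Λ + s • D))
    (φ' := fun s => trace ((g (Λ + s • D))ᵀ * D))
    (U := (fun s : ℝ => Λ + s • D) ⁻¹' S0 A Bu Ba Q R Γ Kbar Pu) hω0.le
    ((isClosed_S0 hQ hR hPu hS hc hlyap).preimage hline) (by simpa using hΛ)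
    (fun s hs hs0 hsω => by
      obtain ⟨hex, hder⟩ := hlocal s hs
      have hslope := (hder.hasDerivWithinAt (s := Set.Ioi s)).limsup_slope_le'
        (lt_irrefl s) (hneg s hs hs0 hsω.le)
      filter_upwards [hex.filter_mono nhdsWithin_le_nhds, hslope, self_mem_nhdsWithin]
        with u hu hu' hsu
      rw [slope_def_field, div_lt_iff₀ (sub_pos.mpr hsu), zero_mul, sub_neg] at hu'
      exact ⟨hu, hu'.le.trans hs.2⟩)
    (fun s hs => (hlocal s hs).2) (fun s hs hs0 hsω => (hneg s hs hs0 hsω).le)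
  simpa using key

theorem Jcost_zero : Jcost Ba R Γ Kbar Pu 0 = ‖R⁻¹ * Baᵀ * Pu 0 - Kbar‖ ^ 2 := by
  simp [Jcost, frobNorm_eq_norm]

end Descent

end Auxiliary

/-- Theorem 2, item 2: the cost is monotonically nonincreasing
along the iteration. -/
theorem stmt7
    (A : Matrix (Fin n) (Fin n) ℝ) (Bu : Matrix (Fin n) (Fin m_u) ℝ)
    (Ba : Matrix (Fin n) (Fin m_a) ℝ)
    (Q : Matrix (Fin n) (Fin n) ℝ) (R : Matrix (Fin m_a) (Fin m_a) ℝ)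
    (Γ : Matrix (Fin m_u) (Fin m_u) ℝ)
    (hQ : Q.PosDef) (hR : R.PosDef) (hΓ : Γ.PosDef)
    (Kbar : Matrix (Fin m_a) (Fin n) ℝ)
    (Pu Pim : Matrix (Fin m_u) (Fin n) ℝ → Matrix (Fin n) (Fin n) ℝ)
    (hPu : ∀ Λ, (∃ P, IsStabSol A Bu Ba Q R Λ P) → IsStabSol A Bu Ba Q R Λ (Pu Λ))
    (hPim : ∀ Λ, (∃ P, IsStabSol A Bu Ba Q R Λ P) →
      IsLyapSol A Bu Ba R Kbar Λ (Pu Λ) (Pim Λ))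
    (h0 : ∃ P, IsStabSol A Bu Ba Q R 0 P)
    (S : Matrix (Fin n) (Fin n) ℝ) (hS : S.PosDef)
    (hSeq : (A + Ba * (R⁻¹ * Baᵀ * Pu 0))ᵀ * S + S * (A + Ba * (R⁻¹ * Baᵀ * Pu 0))
      + (2 : ℝ) • (1 : Matrix (Fin n) (Fin n) ℝ) = 0)
    (ε : ℝ) (hε0 : 0 < ε) (hε1 : ε < 1)
    (hdist : frobNorm (R⁻¹ * Baᵀ * Pu 0 - Kbar) ≤
      (ε / 2) * (Real.sqrt (eigMin Γ) /
        (Real.sqrt (eigMin Γ) * frobNorm (S * Ba) + frobNorm (S * Bu))))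
    (L : ℝ) (hL : 0 < L)
    (hLip : ∀ Λ₁ ∈ S0 A Bu Ba Q R Γ Kbar Pu, ∀ Λ₂ ∈ S0 A Bu Ba Q R Γ Kbar Pu,
      frobNorm ((2 : ℝ) • (Γ * Λ₁ + Buᵀ * Pu Λ₁ * Pim Λ₁) -
          (2 : ℝ) • (Γ * Λ₂ + Buᵀ * Pu Λ₂ * Pim Λ₂)) ≤ L * frobNorm (Λ₁ - Λ₂))
    (ω : ℝ) (hω0 : 0 < ω)
    (hω : ω < (2 / L) * (eigMin Γ⁻¹ / (eigMax Γ⁻¹) ^ 2))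
    (Λseq : ℕ → Matrix (Fin m_u) (Fin n) ℝ)
    (hinit : Λseq 0 ∈ S0 A Bu Ba Q R Γ Kbar Pu)
    (hstep : ∀ i, Λseq (i + 1) = Λseq i +
      ω • (-(Γ⁻¹ * (Buᵀ * Pu (Λseq i) * Pim (Λseq i))) - Λseq i)) :
    ∀ i : ℕ, Jcost Ba R Γ Kbar Pu (Λseq (i + 1)) ≤ Jcost Ba R Γ Kbar Pu (Λseq i) := by
  rcases isEmpty_or_nonempty (Fin m_u) with hm | hm
  · exact fun i => le_of_eq (congrArg _ (Subsingleton.elim _ _))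
  simp only [frobNorm_eq_norm] at hdist hLip
  have hlyap := fun (Λ : Matrix (Fin m_u) (Fin n) ℝ) (P : Matrix (Fin n) (Fin n) ℝ) hcost =>
    lyapunov_of_cost_le (Λ := Λ) (K := R⁻¹ * Baᵀ * P) hΓ hS hSeq hε0 hdist hcost
  simp only [← Jcost_zero (Γ := Γ), ← Matrix.mul_assoc] at hlyap
  have hLω : L * ω < 2 * eigMin Γ := by
    have hmin := eigMin_pos hΓ
    have hmin' := eigMin_pos hΓ.inv
    have hle := eigMin_le_eigMax hΓ.inv.1
    have hmax := hmin'.trans_le hle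
    have hinv : (eigMax Γ⁻¹)⁻¹ ≤ eigMin Γ := inv_le_of_inv_le₀ hmin (inv_eigMin_le_eigMax_inv hΓ)
    have hratio : eigMin Γ⁻¹ / eigMax Γ⁻¹ ^ 2 ≤ (eigMax Γ⁻¹)⁻¹ := by
      rw [div_le_iff₀ (by positivity), pow_two, inv_mul_cancel_left₀ hmax.ne']
      exact hle
    calc L * ω < L * (2 / L * (eigMin Γ⁻¹ / eigMax Γ⁻¹ ^ 2)) := by gcongr
      _ = 2 * (eigMin Γ⁻¹ / eigMax Γ⁻¹ ^ 2) := by rw [← mul_assoc, mul_div_cancel₀ _ hL.ne']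
      _ ≤ 2 * eigMin Γ := by linarith
  have hΓΓ : Γ * Γ⁻¹ = 1 :=
    Matrix.mul_nonsing_inv _ ((Matrix.isUnit_iff_isUnit_det _).mp hΓ.isUnit)
  have hdesc : ∀ i, Λseq i ∈ S0 A Bu Ba Q R Γ Kbar Pu →
      Λseq (i + 1) ∈ S0 A Bu Ba Q R Γ Kbar Pu ∧
        Jcost Ba R Γ Kbar Pu (Λseq (i + 1)) ≤ Jcost Ba R Γ Kbar Pu (Λseq i) := by
    intro i hi
    rw [hstep i]
    refine descent_step hQ hR hΓ hPu hPim hS (by linarith : 0 < 2 * (1 - ε)) hlyap hL hLip hω0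
      hLω hi ?_
    rw [Matrix.mul_sub, Matrix.mul_neg, ← Matrix.mul_assoc Γ, hΓΓ, Matrix.one_mul]
    abel
  have hmem : ∀ i, Λseq i ∈ S0 A Bu Ba Q R Γ Kbar Pu := fun i => by
    induction i with
    | zero => exact hinit
    | succ i ih => exact (hdesc i ih).1
  exact fun i => (hdesc i (hmem i)).2
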